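/- Let (A', B') be a redistribution of a clean optimal pair (A, B). Then at least one of the following holds: (a) |A'| = k and cost(A') equals the minimum of obj over P(k); (b) |B'| = k and cost(B') equals the minimum of obj over P(k); (c) one of the pairs (A, B'), (A, A'), (A', B), (B', B) is a clean optimal pair. -/

import Mathlib

open Finset

noncomputable section

/-- Cost of the assignment `π` (customer `j` is assigned to supplier `π j`)
when the suppliers in `A` are upgraded. -/
def assignCost {n : ℕ} (b c d : Fin n → ℝ) (A : Finset (Fin n))
    (π : Equiv.Perm (Fin n)) : ℝ :=
  ∑ j, (if π j ∈ A then b (π j) else c (π j)) * d j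

/-- `cost A` : minimum assignment cost when upgrading the suppliers in `A`. -/
def cost {n : ℕ} (b c d : Fin n → ℝ) (A : Finset (Fin n)) : ℝ :=
  Finset.univ.inf' Finset.univ_nonempty (assignCost b c d A)

/-- The LP feasible region `P(k)`. -/
def Pk (n k : ℕ) : Set ((Fin n → Fin n → ℝ) × (Fin n → Fin n → ℝ)) :=
  {p | (∀ i j, 0 ≤ p.1 i j) ∧ (∀ i j, 0 ≤ p.2 i j) ∧
    (∀ j, ∑ i, (p.1 i j + p.2 i j) = 1) ∧
    (∀ i, ∑ j, (p.1 i j + p.2 i j) = 1) ∧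
    (∑ i, ∑ j, p.1 i j) ≤ (k : ℝ)}

/-- The LP objective. -/
def obj {n : ℕ} (b c d : Fin n → ℝ)
    (p : (Fin n → Fin n → ℝ) × (Fin n → Fin n → ℝ)) : ℝ :=
  ∑ i, ∑ j, (b i * p.1 i j + c i * p.2 i j) * d j

/-- A point is integral if all of its entries lie in `{0, 1}`. -/
def Integral {n : ℕ} (p : (Fin n → Fin n → ℝ) × (Fin n → Fin n → ℝ)) : Prop :=
  (∀ i j, p.1 i j = 0 ∨ p.1 i j = 1) ∧ (∀ i j, p.2 i j = 0 ∨ p.2 i j = 1)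

/-- `f_{A,B}(k)`. -/
def fpair {n : ℕ} (b c d : Fin n → ℝ) (k : ℕ) (A B : Finset (Fin n)) : ℝ :=
  (((B.card : ℝ) - k) * cost b c d A + ((k : ℝ) - A.card) * cost b c d B) /
    ((B.card : ℝ) - A.card)

/-- `(A, B)` is an optimal pair. -/
def OptimalPair {n : ℕ} (b c d : Fin n → ℝ) (k : ℕ) (A B : Finset (Fin n)) : Prop :=
  A.card < k ∧ k < B.card ∧ IsLeast (obj b c d '' Pk n k) (fpair b c d k A B)

/-- `X` is simple: some optimal assignment for upgrading `X` assigns every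
upgraded supplier to a customer with positive demand. -/
def SimpleSet {n : ℕ} (b c d : Fin n → ℝ) (X : Finset (Fin n)) : Prop :=
  ∃ π : Equiv.Perm (Fin n), assignCost b c d X π = cost b c d X ∧
    ∀ j, π j ∈ X → 0 < d j

/-- `(A, B)` is clean. -/
def Clean {n : ℕ} (b c : Fin n → ℝ) (A B : Finset (Fin n)) : Prop :=
  ∀ i ∈ symmDiff A B, ∀ i' ∈ symmDiff A B, ¬ (b i < b i' ∧ c i' < c i)

/-- `(A', B')` is a redistribution of `(A, B)` : the elements of `A ∆ B` are
enumerated `e 0, e 1, …` with `b` and `c` both nondecreasing along the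
enumeration, the elements with odd (0-based) index go to `A'` and those with
even (0-based) index go to `B'` (on top of `A ∩ B`). -/
def Redistribution {n : ℕ} (b c : Fin n → ℝ) (A B A' B' : Finset (Fin n)) : Prop :=
  ∃ (ℓ : ℕ) (e : Fin ℓ → Fin n), Function.Injective e ∧
    Finset.image e Finset.univ = symmDiff A B ∧
    Monotone (b ∘ e) ∧ Monotone (c ∘ e) ∧
    A' = (A ∩ B) ∪
      Finset.image e ((Finset.univ : Finset (Fin ℓ)).filter (fun s => (s : ℕ) % 2 = 1)) ∧
    B' = (A ∩ B) ∪
      Finset.image e ((Finset.univ : Finset (Fin ℓ)).filter (fun s => (s : ℕ) % 2 = 0))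

/-- The 0/1 point of the LP corresponding to assignment `π` with upgraded set `A`. -/
def chi {n : ℕ} (π : Equiv.Perm (Fin n)) (A : Finset (Fin n)) :
    (Fin n → Fin n → ℝ) × (Fin n → Fin n → ℝ) :=
  (fun i j => if π j = i ∧ i ∈ A then 1 else 0,
   fun i j => if π j = i ∧ i ∉ A then 1 else 0)

/-- `hval k'` : minimum of `cost X` over all `X` of cardinality `k'`. -/
def hval {n : ℕ} (b c d : Fin n → ℝ) (k' : ℕ) : ℝ :=
  sInf {v | ∃ X : Finset (Fin n), X.card = k' ∧ cost b c d X = v}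

end

/-- The cost of supplier `i` when the suppliers in `X` are upgraded. -/
def effCost {n : ℕ} (b c : Fin n → ℝ) (X : Finset (Fin n)) (i : Fin n) : ℝ :=
  if i ∈ X then b i else c i

lemma assignCost_eq_sum_effCost {n : ℕ} (b c d : Fin n → ℝ) (X : Finset (Fin n))
    (π : Equiv.Perm (Fin n)) :
    assignCost b c d X π = ∑ j, effCost b c X (π j) * d j := rfl

lemma exists_assignCost_eq_cost {n : ℕ} (b c d : Fin n → ℝ) (X : Finset (Fin n)) :
    ∃ π, assignCost b c d X π = cost b c d X := by
  obtain ⟨π, -, h⟩ := Finset.exists_mem_eq_inf' Finset.univ_nonempty (assignCost b c d X)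
  exact ⟨π, h.symm⟩

lemma cost_le_assignCost {n : ℕ} (b c d : Fin n → ℝ) (X : Finset (Fin n))
    (π : Equiv.Perm (Fin n)) : cost b c d X ≤ assignCost b c d X π :=
  Finset.inf'_le _ (Finset.mem_univ π)

/-! ### Integral points of the LP and their convex combinations -/

lemma chi_add {n : ℕ} (π : Equiv.Perm (Fin n)) (X : Finset (Fin n)) (i j : Fin n) :
    (chi π X).1 i j + (chi π X).2 i j = if π j = i then 1 else 0 := by
  by_cases hi : i ∈ X <;> simp [chi, hi]

lemma sum_chi_fst {n : ℕ} (π : Equiv.Perm (Fin n)) (X : Finset (Fin n)) :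
    ∑ i, ∑ j, (chi π X).1 i j = X.card := by
  have h : ∀ i, ∑ j, (chi π X).1 i j = if i ∈ X then 1 else 0 := by
    intro i
    by_cases hi : i ∈ X <;> simp [chi, hi, ← Equiv.eq_symm_apply]
  simp [h]

lemma obj_chi {n : ℕ} (b c d : Fin n → ℝ) (π : Equiv.Perm (Fin n)) (X : Finset (Fin n)) :
    obj b c d (chi π X) = assignCost b c d X π := by
  rw [obj, Finset.sum_comm, assignCost]
  refine Finset.sum_congr rfl fun j _ => ?_
  rw [Finset.sum_eq_single (π j)]
  · by_cases hi : π j ∈ X <;> simp [chi, hi]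
  · intro i _ hi
    simp [chi, hi.symm]
  · simp

lemma obj_add_smul {n : ℕ} (b c d : Fin n → ℝ) (s t : ℝ)
    (p q : (Fin n → Fin n → ℝ) × (Fin n → Fin n → ℝ)) :
    obj b c d (s • p + t • q) = s * obj b c d p + t * obj b c d q := by
  simp only [obj, Finset.mul_sum, ← Finset.sum_add_distrib]
  refine Finset.sum_congr rfl fun i _ => Finset.sum_congr rfl fun j _ => ?_
  simp only [Prod.fst_add, Prod.snd_add, Prod.smul_fst, Prod.smul_snd, Pi.add_apply,
    Pi.smul_apply, smul_eq_mul]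
  ring

lemma chi_combination_mem_Pk {n k : ℕ} (π ρ : Equiv.Perm (Fin n)) (X Y : Finset (Fin n))
    {s t : ℝ} (hs : 0 ≤ s) (ht : 0 ≤ t) (hst : s + t = 1)
    (hk : s * X.card + t * Y.card ≤ k) : s • chi π X + t • chi ρ Y ∈ Pk n k := by
  have h0 : ∀ (π : Equiv.Perm (Fin n)) (X : Finset (Fin n)) (i j : Fin n),
      0 ≤ (chi π X).1 i j ∧ 0 ≤ (chi π X).2 i j := by
    intro π X i j
    constructor <;> simp only [chi] <;> split_ifs <;> norm_num
  have hadd : ∀ i j, (s • chi π X + t • chi ρ Y).1 i j + (s • chi π X + t • chi ρ Y).2 i j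
      = s * (if π j = i then 1 else 0) + t * (if ρ j = i then 1 else 0) := by
    intro i j
    rw [← chi_add π X, ← chi_add ρ Y]
    simp only [Prod.fst_add, Prod.snd_add, Prod.smul_fst, Prod.smul_snd, Pi.add_apply,
      Pi.smul_apply, smul_eq_mul]
    ring
  refine ⟨fun i j => ?_, fun i j => ?_, fun j => ?_, fun i => ?_, ?_⟩
  · exact add_nonneg (mul_nonneg hs (h0 π X i j).1) (mul_nonneg ht (h0 ρ Y i j).1)
  · exact add_nonneg (mul_nonneg hs (h0 π X i j).2) (mul_nonneg ht (h0 ρ Y i j).2)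
  · simp only [hadd, Finset.sum_add_distrib, ← Finset.mul_sum]
    simp [hst]
  · simp only [hadd, Finset.sum_add_distrib, ← Finset.mul_sum]
    simp [← Equiv.eq_symm_apply, hst]
  · refine le_of_eq_of_le ?_ hk
    rw [← sum_chi_fst π X, ← sum_chi_fst ρ Y]
    simp only [Finset.mul_sum, ← Finset.sum_add_distrib]
    rfl

/-- A lower bound for the LP on `Pk n k` lies below the chord through `(|X|, cost X)` and
`(|Y|, cost Y)` at `k`. -/
lemma lowerBound_mul_le {n k : ℕ} {b c d : Fin n → ℝ} {v : ℝ}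
    (hv : v ∈ lowerBounds (obj b c d '' Pk n k)) {X Y : Finset (Fin n)}
    (hX : X.card ≤ k) (hY : k ≤ Y.card) (hXY : X.card < Y.card) :
    ((Y.card : ℝ) - X.card) * v ≤
      ((Y.card : ℝ) - k) * cost b c d X + ((k : ℝ) - X.card) * cost b c d Y := by
  obtain ⟨π, hπ⟩ := exists_assignCost_eq_cost b c d X
  obtain ⟨ρ, hρ⟩ := exists_assignCost_eq_cost b c d Y
  have hX' : (X.card : ℝ) ≤ k := by exact_mod_cast hX
  have hY' : (k : ℝ) ≤ Y.card := by exact_mod_cast hY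
  have hpos : (0 : ℝ) < (Y.card : ℝ) - X.card := sub_pos.2 (by exact_mod_cast hXY)
  have hmem := chi_combination_mem_Pk (k := k) π ρ X Y
    (s := ((Y.card : ℝ) - k) / ((Y.card : ℝ) - X.card))
    (t := ((k : ℝ) - X.card) / ((Y.card : ℝ) - X.card))
    (div_nonneg (sub_nonneg.2 hY') hpos.le) (div_nonneg (sub_nonneg.2 hX') hpos.le)
    (by field_simp; ring) (le_of_eq (by field_simp; ring))
  have h := hv ⟨_, hmem, rfl⟩
  rw [obj_add_smul, obj_chi, obj_chi, hπ, hρ] at h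
  calc ((Y.card : ℝ) - X.card) * v ≤ _ := mul_le_mul_of_nonneg_left h hpos.le
    _ = _ := by field_simp

/-- The line through the points of an optimal pair lies below all points `(|X|, cost X)`. -/
lemma OptimalPair.line_le_cost {n k : ℕ} {b c d : Fin n → ℝ} {A B : Finset (Fin n)}
    (h : OptimalPair b c d k A B) (X : Finset (Fin n)) :
    ((B.card : ℝ) - X.card) * cost b c d A + ((X.card : ℝ) - A.card) * cost b c d B ≤
      ((B.card : ℝ) - A.card) * cost b c d X := by
  obtain ⟨hA, hB, -, hv⟩ := h
  have hA' : (A.card : ℝ) < k := by exact_mod_cast hA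
  have hB' : (k : ℝ) < B.card := by exact_mod_cast hB
  have hpos : (0 : ℝ) < (B.card : ℝ) - A.card := by linarith
  have hf : ((B.card : ℝ) - A.card) * fpair b c d k A B =
      ((B.card : ℝ) - k) * cost b c d A + ((k : ℝ) - A.card) * cost b c d B := by
    rw [fpair]
    field_simp
  rcases le_total X.card k with hX | hX
  · have h1 := mul_le_mul_of_nonneg_left
      (lowerBound_mul_le hv hX hB.le (hX.trans_lt hB)) hpos.le
    refine le_of_mul_le_mul_left ?_ (sub_pos.2 hB')
    linear_combination h1 - ((B.card : ℝ) - X.card) * hf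
  · have h1 := mul_le_mul_of_nonneg_left
      (lowerBound_mul_le hv hA.le hX (hA.trans_le hX)) hpos.le
    refine le_of_mul_le_mul_left ?_ (sub_pos.2 hA')
    linear_combination h1 - ((X.card : ℝ) - A.card) * hf

/-! ### Interleaving of sorted cost vectors -/

/-- The alternating sum over an initial segment of `Fin ℓ` is `0` or `1`. -/
lemma alternating_sum_antitone (ℓ : ℕ) (p : Fin ℓ → Prop) [DecidablePred p]
    (hp : ∀ s t, s ≤ t → p t → p s) :
    (∑ s, if p s then (-1 : ℤ) ^ (s : ℕ) else 0) = 0 ∨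
      (∑ s, if p s then (-1 : ℤ) ^ (s : ℕ) else 0) = 1 := by
  induction ℓ with
  | zero => simp
  | succ ℓ ih =>
    by_cases h0 : p 0
    · have hs : (∑ s : Fin ℓ, if p s.succ then (-1 : ℤ) ^ ((s.succ : Fin (ℓ + 1)) : ℕ) else 0) =
          -∑ s : Fin ℓ, if p s.succ then (-1 : ℤ) ^ (s : ℕ) else 0 := by
        rw [← Finset.sum_neg_distrib]
        refine Finset.sum_congr rfl fun s _ => ?_
        split_ifs <;> simp [pow_succ]
      have := ih (fun s => p s.succ) fun s t hst => hp _ _ (Fin.succ_le_succ_iff.2 hst)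
      rw [Fin.sum_univ_succ, hs]
      simp only [h0, if_true, Fin.val_zero, pow_zero]
      omega
    · left
      refine Finset.sum_eq_zero fun s _ => ?_
      rw [if_neg fun hs => h0 (hp 0 s (Fin.zero_le s) hs)]

lemma Monotone.le_of_card_filter_le {n : ℕ} {f g : Fin n → ℝ} (hf : Monotone f)
    (hg : Monotone g)
    (h : ∀ x, (univ.filter (g · ≤ x)).card ≤ (univ.filter (f · ≤ x)).card + 1)
    {m m' : Fin n} (hm : m < m') : f m ≤ g m' := by
  by_contra! hlt
  have h1 : (Finset.Iic m').card ≤ (univ.filter (g · ≤ g m')).card :=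
    Finset.card_le_card fun i hi => by simpa using hg (Finset.mem_Iic.1 hi)
  have h2 : (univ.filter (f · ≤ g m')).card ≤ (Finset.Iio m).card := by
    refine Finset.card_le_card fun i hi => ?_
    simp only [Finset.mem_filter, Finset.mem_univ, true_and] at hi
    exact Finset.mem_Iio.2 (hf.reflect_lt (hi.trans_lt hlt))
  have h3 := h (g m')
  rw [Fin.card_Iic] at h1
  rw [Fin.card_Iio] at h2
  have : (m : ℕ) < m' := hm
  omega

/-- If each supplier is upgraded equally often in `(A, B)` and `(A', B')`, and the sorted
effective costs of `A'` and `B'` interleave, then `(A', B')` has the smaller total cost. -/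
lemma cost_add_cost_le {n : ℕ} (b c d : Fin n → ℝ) {A B A' B' : Finset (Fin n)}
    (hmem : ∀ i, (i ∈ A' ↔ i ∈ A) ∧ (i ∈ B' ↔ i ∈ B) ∨ (i ∈ A' ↔ i ∈ B) ∧ (i ∈ B' ↔ i ∈ A))
    (h₁ : ∀ x, (univ.filter (effCost b c A' · ≤ x)).card ≤
      (univ.filter (effCost b c B' · ≤ x)).card + 1)
    (h₂ : ∀ x, (univ.filter (effCost b c B' · ≤ x)).card ≤
      (univ.filter (effCost b c A' · ≤ x)).card + 1) :
    cost b c d A' + cost b c d B' ≤ cost b c d A + cost b c d B := by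
  obtain ⟨π, hπ⟩ := exists_assignCost_eq_cost b c d A
  obtain ⟨ρ, hρ⟩ := exists_assignCost_eq_cost b c d B
  let r : Equiv.Perm (Fin n) := (Tuple.sort d).symm.trans Fin.revPerm
  let σ (X : Finset (Fin n)) : Equiv.Perm (Fin n) := r.trans (Tuple.sort (effCost b c X))
  have hr : ∀ j j', d j < d j' → r j' < r j := by
    intro j j' hj
    have := (Tuple.monotone_sort d).reflect_lt (a := (Tuple.sort d).symm j)
      (b := (Tuple.sort d).symm j') (by simpa using hj)
    simpa [r] using this
  have hsort : ∀ X Y : Finset (Fin n),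
      (∀ x, (univ.filter (effCost b c Y · ≤ x)).card ≤
        (univ.filter (effCost b c X · ≤ x)).card + 1) →
      ∀ j j', d j < d j' → effCost b c X (σ X j') ≤ effCost b c Y (σ Y j) := by
    intro X Y hXY j j' hj
    have hcard : ∀ (Z : Finset (Fin n)) (x : ℝ),
        (univ.filter ((effCost b c Z ∘ Tuple.sort (effCost b c Z)) · ≤ x)).card =
          (univ.filter (effCost b c Z · ≤ x)).card := by
      intro Z x
      simp only [Finset.card_filter]
      exact Equiv.sum_comp (Tuple.sort (effCost b c Z)) fun i =>
        if effCost b c Z i ≤ x then 1 else 0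
    refine Monotone.le_of_card_filter_le (Tuple.monotone_sort (effCost b c X))
      (Tuple.monotone_sort (effCost b c Y)) ?_ (hr j j' hj)
    intro x
    rw [hcard, hcard]
    exact hXY x
  let V : Fin n ⊕ Fin n → ℝ := Sum.elim (effCost b c A) (effCost b c B)
  let V' : Fin n ⊕ Fin n → ℝ := Sum.elim (effCost b c A') (effCost b c B')
  let D : Fin n ⊕ Fin n → ℝ := Sum.elim d d
  let sw : Fin n ⊕ Fin n → Fin n ⊕ Fin n :=
    Sum.elim (fun i => if i ∈ A' ↔ i ∈ A then .inl i else .inr i)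
      (fun i => if i ∈ A' ↔ i ∈ A then .inr i else .inl i)
  have hsw : Function.Involutive sw := by
    rintro (i | i) <;> by_cases hi : i ∈ A' ↔ i ∈ A <;> simp [sw, hi]
  have hV : ∀ x, V' (sw x) = V x := by
    have hcongr : ∀ X Y : Finset (Fin n), ∀ i, (i ∈ X ↔ i ∈ Y) →
        effCost b c X i = effCost b c Y i := fun X Y i hXY => by simp [effCost, hXY]
    rintro (i | i) <;> by_cases hi : i ∈ A' ↔ i ∈ A <;>
      simp only [V, V', sw, Sum.elim_inl, Sum.elim_inr, hi, if_true, if_false] <;>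
      refine hcongr _ _ _ ?_ <;> have := hmem i <;> tauto
  let E : Equiv.Perm (Fin n ⊕ Fin n) := Equiv.sumCongr π ρ
  let E' : Equiv.Perm (Fin n ⊕ Fin n) := Equiv.sumCongr (σ A') (σ B')
  have hanti : Antivary (V' ∘ E') D := by
    rintro (j | j) (j' | j') hj
    · exact hsort A' A' (fun x => Nat.le_succ _) j j' hj
    · exact hsort B' A' h₁ j j' hj
    · exact hsort A' B' h₂ j j' hj
    · exact hsort B' B' (fun x => Nat.le_succ _) j j' hj
  have key := hanti.sum_mul_le_sum_comp_perm_mul (σ := (E.trans hsw.toPerm).trans E'.symm)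
  have hL : ∑ x, (V' ∘ E') x * D x = assignCost b c d A' (σ A') + assignCost b c d B' (σ B') := by
    rw [Fintype.sum_sum_type]
    rfl
  have hR : ∑ x, (V' ∘ E') (((E.trans hsw.toPerm).trans E'.symm) x) * D x =
      assignCost b c d A π + assignCost b c d B ρ := by
    simp only [Function.comp_apply, Equiv.trans_apply, Equiv.apply_symm_apply,
      Function.Involutive.coe_toPerm, hV]
    rw [Fintype.sum_sum_type]
    rfl
  rw [hL, hR, hπ, hρ] at key
  exact (add_le_add (cost_le_assignCost b c d A' _) (cost_le_assignCost b c d B' _)).trans key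

/-! ### Redistributions -/

lemma Redistribution.mem {n : ℕ} {b c : Fin n → ℝ} {A B A' B' : Finset (Fin n)}
    (h : Redistribution b c A B A' B') (i : Fin n) :
    (i ∈ A' ↔ i ∈ A) ∧ (i ∈ B' ↔ i ∈ B) ∨ (i ∈ A' ↔ i ∈ B) ∧ (i ∈ B' ↔ i ∈ A) := by
  obtain ⟨ℓ, e, he, himg, -, -, rfl, rfl⟩ := h
  by_cases hi : i ∈ symmDiff A B
  · have hi' := hi
    rw [← himg, Finset.mem_image] at hi'
    obtain ⟨s, -, rfl⟩ := hi'
    rw [Finset.mem_symmDiff] at hi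
    simp only [Finset.mem_union, Finset.mem_inter, Finset.mem_image, Finset.mem_filter,
      Finset.mem_univ, true_and, he.eq_iff, exists_eq_right]
    rcases Nat.mod_two_eq_zero_or_one s with hs | hs <;> rw [hs] <;> simp <;> tauto
  · have hne : ∀ s, e s ≠ i := by
      rintro s rfl
      exact hi (himg ▸ Finset.mem_image_of_mem e (Finset.mem_univ s))
    rw [Finset.mem_symmDiff] at hi
    simp only [Finset.mem_union, Finset.mem_inter, Finset.mem_image, hne, and_false, exists_false,
      or_false]
    tauto

lemma Redistribution.card_add_card {n : ℕ} {b c : Fin n → ℝ} {A B A' B' : Finset (Fin n)}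
    (h : Redistribution b c A B A' B') : A'.card + B'.card = A.card + B.card := by
  have hcard : ∀ X : Finset (Fin n), X.card = ∑ i, if i ∈ X then 1 else 0 := by simp
  simp only [hcard, ← Finset.sum_add_distrib]
  refine Finset.sum_congr rfl fun i _ => ?_
  rcases h.mem i with ⟨h1, h2⟩ | ⟨h1, h2⟩ <;> simp only [h1, h2]
  exact add_comm _ _

lemma Redistribution.card_filter_sub {n : ℕ} {b c : Fin n → ℝ} {A B A' B' : Finset (Fin n)}
    (h : Redistribution b c A B A' B') (x : ℝ) :
    |((univ.filter (effCost b c B' · ≤ x)).card : ℤ) -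
      (univ.filter (effCost b c A' · ≤ x)).card| ≤ 1 := by
  obtain ⟨ℓ, e, he, himg, hmb, hmc, hA', hB'⟩ := h
  have hA : ∀ s, e s ∈ A' ↔ (s : ℕ) % 2 = 1 := by
    intro s
    have hs : e s ∉ A ∩ B := by
      have := himg ▸ Finset.mem_image_of_mem e (Finset.mem_univ s)
      rw [Finset.mem_symmDiff] at this
      rw [Finset.mem_inter]
      tauto
    simp [hA', hs, he.eq_iff, -Finset.mem_inter]
  have hB : ∀ s, e s ∈ B' ↔ (s : ℕ) % 2 = 0 := by
    intro s
    have hs : e s ∉ A ∩ B := by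
      have := himg ▸ Finset.mem_image_of_mem e (Finset.mem_univ s)
      rw [Finset.mem_symmDiff] at this
      rw [Finset.mem_inter]
      tauto
    simp [hB', hs, he.eq_iff, -Finset.mem_inter]
  have hsum : ((univ.filter (effCost b c B' · ≤ x)).card : ℤ) -
      (univ.filter (effCost b c A' · ≤ x)).card =
      (∑ s, if b (e s) ≤ x then (-1 : ℤ) ^ (s : ℕ) else 0) -
        ∑ s, if c (e s) ≤ x then (-1 : ℤ) ^ (s : ℕ) else 0 := by
    simp only [Finset.card_filter, Nat.cast_sum, ← Finset.sum_sub_distrib]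
    rw [← Finset.sum_subset (Finset.subset_univ (Finset.image e univ)),
      Finset.sum_image he.injOn]
    · refine Finset.sum_congr rfl fun s _ => ?_
      rcases Nat.mod_two_eq_zero_or_one s with hs | hs
      · simp [effCost, hA, hB, hs, (Nat.even_iff.2 hs).neg_one_pow]
      · simp only [effCost, hA, hB, hs, (Nat.odd_iff.2 hs).neg_one_pow]
        split_ifs <;> simp_all
    · intro i _ hi
      have hne : ∀ s, e s ≠ i := fun s hs => hi (hs ▸ Finset.mem_image_of_mem e (Finset.mem_univ s))
      have hAB : i ∈ A' ↔ i ∈ B' := by simp [hA', hB', hne]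
      simp only [effCost, hAB]
      exact sub_self _
  rw [hsum]
  have h1 := alternating_sum_antitone ℓ (fun s => b (e s) ≤ x)
    fun s t hst ht => (hmb hst).trans ht
  have h2 := alternating_sum_antitone ℓ (fun s => c (e s) ≤ x)
    fun s t hst ht => (hmc hst).trans ht
  rw [abs_le]
  omega

lemma Redistribution.cost_add_cost_le {n : ℕ} {b c : Fin n → ℝ} (d : Fin n → ℝ)
    {A B A' B' : Finset (Fin n)} (h : Redistribution b c A B A' B') :
    cost b c d A' + cost b c d B' ≤ cost b c d A + cost b c d B := by
  refine _root_.cost_add_cost_le b c d h.mem (fun x => ?_) fun x => ?_ <;>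
  · have := abs_le.1 (h.card_filter_sub x)
    omega

/-- A redistribution of an optimal pair lies on the line through that pair. -/
lemma Redistribution.cost_eq {n k : ℕ} {b c d : Fin n → ℝ} {A B A' B' : Finset (Fin n)}
    (h : Redistribution b c A B A' B') (hopt : OptimalPair b c d k A B) :
    ((B.card : ℝ) - A.card) * cost b c d A' =
      ((B.card : ℝ) - A'.card) * cost b c d A + ((A'.card : ℝ) - A.card) * cost b c d B := by
  have hpos : (0 : ℝ) < (B.card : ℝ) - A.card :=
    sub_pos.2 (by exact_mod_cast hopt.1.trans hopt.2.1)
  have hcard : (A'.card : ℝ) + B'.card = A.card + B.card := by exact_mod_cast h.card_add_card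
  refine le_antisymm ?_ (hopt.line_le_cost A')
  have h1 := mul_le_mul_of_nonneg_left (h.cost_add_cost_le d) hpos.le
  linear_combination h1 + hopt.line_le_cost B' + (cost b c d A - cost b c d B) * hcard

lemma Clean.mono {n : ℕ} {b c : Fin n → ℝ} {A B X Y : Finset (Fin n)} (h : Clean b c A B)
    (hXY : symmDiff X Y ⊆ symmDiff A B) : Clean b c X Y :=
  fun i hi j hj => h i (hXY hi) j (hXY hj)

/-- a redistribution of a clean optimal pair either yields an
optimal integral solution or a new clean optimal pair. -/
theorem stmt7 (n : ℕ) (hn : 1 ≤ n) (b c d : Fin n → ℝ)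
    (hb : ∀ i, 0 ≤ b i) (hbc : ∀ i, b i ≤ c i) (hd : ∀ j, 0 ≤ d j) (k : ℕ)
    (A B A' B' : Finset (Fin n))
    (hopt : OptimalPair b c d k A B) (hclean : Clean b c A B)
    (hred : Redistribution b c A B A' B') :
    (A'.card = k ∧ IsLeast (obj b c d '' Pk n k) (cost b c d A')) ∨
    (B'.card = k ∧ IsLeast (obj b c d '' Pk n k) (cost b c d B')) ∨
    (Clean b c A B' ∧ OptimalPair b c d k A B') ∨
    (Clean b c A A' ∧ OptimalPair b c d k A A') ∨
    (Clean b c A' B ∧ OptimalPair b c d k A' B) ∨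
    (Clean b c B' B ∧ OptimalPair b c d k B' B) := by
  have hline := hred.cost_eq hopt
  obtain ⟨hA, hB, hleast⟩ := hopt
  have hA' : (A.card : ℝ) < k := by exact_mod_cast hA
  have hB' : (k : ℝ) < B.card := by exact_mod_cast hB
  have hAB : (B.card : ℝ) - A.card ≠ 0 := by linarith
  rcases lt_trichotomy A'.card k with hlt | heq | hgt
  · have hlt' : (A'.card : ℝ) < k := by exact_mod_cast hlt
    have hne : (B.card : ℝ) - A'.card ≠ 0 := by linarith
    refine .inr <| .inr <| .inr <| .inr <| .inl ⟨hclean.mono fun i hi => ?_, hlt, hB, ?_⟩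
    · have := hred.mem i
      rw [Finset.mem_symmDiff] at hi ⊢
      tauto
    · convert hleast using 1
      rw [fpair, fpair, div_eq_div_iff hne hAB]
      linear_combination ((B.card : ℝ) - k) * hline
  · refine .inl ⟨heq, ?_⟩
    convert hleast using 1
    rw [fpair, eq_div_iff hAB, ← heq]
    linear_combination hline
  · have hgt' : (k : ℝ) < A'.card := by exact_mod_cast hgt
    have hne : (A'.card : ℝ) - A.card ≠ 0 := by linarith
    refine .inr <| .inr <| .inr <| .inl ⟨hclean.mono fun i hi => ?_, hA, hgt, ?_⟩
    · have := hred.mem i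
      rw [Finset.mem_symmDiff] at hi ⊢
      tauto
    · convert hleast using 1
      rw [fpair, fpair, div_eq_div_iff hne hAB]
      linear_combination ((k : ℝ) - A.card) * hline
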